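/- Let G be a group, δ₁, δ₂ : G → ZMod 2 group homomorphisms, and for i = 1, 2 let πᵢ : Hᵢ → G be a surjective group homomorphism and ιᵢ : Circle → Hᵢ an injective group homomorphism whose image is central in Hᵢ and equals ker πᵢ. Form the sum extensions both ways: P₁₂ = {(x, y) ∈ H₁ × H₂ : π₁(x) = π₂(y)} with product (x₁,y₁)(x₂,y₂) = (ι₁((-1)^{(δ₂(π₁x₁)·δ₁(π₁x₂)).val}) x₁x₂, y₁y₂), quotiented by D₁₂ = {(ι₁(μ), ι₂(μ⁻¹))}; and P₂₁ = {(y, x) ∈ H₂ × H₁ : π₂(y) = π₁(x)} with product (y₁,x₁)(y₂,x₂) = (ι₂((-1)^{(δ₁(π₂y₁)·δ₂(π₂y₂)).val}) y₁y₂, x₁x₂), quotiented by D₂₁ = {(ι₂(μ), ι₁(μ⁻¹))}. Then the map P₁₂/D₁₂ → P₂₁/D₂₁ sending the class of (x, y) to the class of (ι₂((-1)^{(δ₁(g)·δ₂(g)).val}) y, x), where g = π₁(x), is a well-defined group isomorphism commuting with the maps to G and the embeddings of Circle. (This shows the sum of graded central extensions is commutative.) -/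

import Mathlib

/-- The element `-1` of the circle group. -/
noncomputable def Circle.negOne : Circle :=
  ⟨-1, by show -1 ∈ Submonoid.unitSphere ℂ; simp [Submonoid.unitSphere]⟩

/-- The underlying set of the fiber product of two groups over `G`, used for sums of
(graded) central extensions of `G`. -/
abbrev FiberProd {G H₁ H₂ : Type*} [Group G] [Group H₁] [Group H₂]
    (π₁ : H₁ →* G) (π₂ : H₂ →* G) : Type _ :=
  {p : H₁ × H₂ // π₁ p.1 = π₂ p.2}

/-- The Koszul sign is additive in the exponent. -/
theorem negOne_pow_val_add (a b : ZMod 2) :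
    Circle.negOne ^ (a + b).val = Circle.negOne ^ a.val * Circle.negOne ^ b.val := by
  have h : Circle.negOne * Circle.negOne = 1 := by
    apply Circle.ext
    rw [Circle.coe_mul, Circle.coe_one]
    change (-1 : ℂ) * (-1 : ℂ) = 1
    norm_num
  have hab : ∀ x : ZMod 2, x = 0 ∨ x = 1 := by decide
  have h11 : (1 + 1 : ZMod 2) = 0 := by decide
  have hv : (1 : ZMod 2).val = 1 := rfl
  rcases hab a with rfl | rfl <;> rcases hab b with rfl | rfl <;> simp [h, h11, hv]

theorem negOne_pow_val_mul_self (a : ZMod 2) :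
    Circle.negOne ^ a.val * Circle.negOne ^ a.val = 1 := by
  rw [← negOne_pow_val_add, CharTwo.add_self_eq_zero]
  simp

/-- Equality of classes in a sum extension. -/
theorem sum_mk_eq_iff {G H K : Type*} [Group G] [Group H] [Group K]
    (δ ε : G → ZMod 2)
    (hδ : ∀ g h : G, δ (g * h) = δ g + δ h)
    (π : H →* G) (ι : Circle →* H)
    (hcent : ι.range ≤ Subgroup.center H) (hker : ι.range = π.ker)
    (σ : K →* G) (κ : Circle →* K)
    (hcent' : κ.range ≤ Subgroup.center K) (hker' : κ.range = σ.ker)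
    [Group (FiberProd π σ)]
    (hmul : ∀ p q : FiberProd π σ,
      (p * q).1 =
        (ι (Circle.negOne ^ (ε (π p.1.1) * δ (π q.1.1)).val) * (p.1.1 * q.1.1),
         p.1.2 * q.1.2))
    (D : Subgroup (FiberProd π σ))
    (hD : ∀ p : FiberProd π σ, p ∈ D ↔ ∃ μ : Circle, p.1 = (ι μ, κ μ⁻¹))
    (a b : FiberProd π σ) :
    ((QuotientGroup.mk a : FiberProd π σ ⧸ D) = QuotientGroup.mk b) ↔
      ∃ μ : Circle, b.1.1 = ι μ * a.1.1 ∧ b.1.2 = κ μ⁻¹ * a.1.2 := by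
  have hδ1 : δ 1 = 0 := by simpa using hδ 1 1
  have hπι : ∀ μ, π (ι μ) = 1 := fun μ => by
    have : ι μ ∈ π.ker := hker ▸ ⟨μ, rfl⟩
    exact this
  have hσκ : ∀ μ, σ (κ μ) = 1 := fun μ => by
    have : κ μ ∈ σ.ker := hker' ▸ ⟨μ, rfl⟩
    exact this
  have hc : ∀ μ x, x * ι μ = ι μ * x := fun μ x =>
    Subgroup.mem_center_iff.1 (hcent ⟨μ, rfl⟩) x
  have hc' : ∀ μ x, x * κ μ = κ μ * x := fun μ x =>
    Subgroup.mem_center_iff.1 (hcent' ⟨μ, rfl⟩) x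
  have key : ∀ (d : FiberProd π σ) (μ : Circle), d.1 = (ι μ, κ μ⁻¹) →
      (a * d).1 = (ι μ * a.1.1, κ μ⁻¹ * a.1.2) := by
    intro d μ hd
    rw [hmul, hd]
    simp only [hπι, hδ1, mul_zero, ZMod.val_zero, pow_zero, map_one, one_mul, hc, hc']
  rw [QuotientGroup.eq, hD]
  constructor
  · rintro ⟨μ, hμ⟩
    have := key _ μ hμ
    rw [mul_inv_cancel_left] at this
    exact ⟨μ, by rw [this], by rw [this]⟩
  · rintro ⟨μ, h1, h2⟩
    refine ⟨μ, ?_⟩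
    let d : FiberProd π σ := ⟨(ι μ, κ μ⁻¹), by simp only [hπι, hσκ]⟩
    have hb : b = a * d := by
      apply Subtype.ext
      rw [key d μ rfl]
      exact Prod.ext h1 h2
    rw [hb, inv_mul_cancel_left]

/-- The sum of two graded central extensions of `G` by `Circle` is
commutative: the map `[(x, y)] ↦ [(ι₂((-1)^{δ₁(g)·δ₂(g)}) y, x)]`, `g = π₁ x`, is a
well-defined group isomorphism between the two sum extensions `P₁₂ ⧸ D₁₂` and `P₂₁ ⧸ D₂₁`,
commuting with the projections to `G` and the embeddings of `Circle`. -/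
theorem sum_of_graded_central_extensions_comm
    (G H₁ H₂ : Type*) [Group G] [Group H₁] [Group H₂]
    (δ₁ δ₂ : G → ZMod 2)
    (hδ₁ : ∀ g h : G, δ₁ (g * h) = δ₁ g + δ₁ h)
    (hδ₂ : ∀ g h : G, δ₂ (g * h) = δ₂ g + δ₂ h)
    (π₁ : H₁ →* G) (hπ₁ : Function.Surjective π₁)
    (ι₁ : Circle →* H₁) (hι₁ : Function.Injective ι₁)
    (hcent₁ : ι₁.range ≤ Subgroup.center H₁) (hker₁ : ι₁.range = π₁.ker)
    (π₂ : H₂ →* G) (hπ₂ : Function.Surjective π₂)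
    (ι₂ : Circle →* H₂) (hι₂ : Function.Injective ι₂)
    (hcent₂ : ι₂.range ≤ Subgroup.center H₂) (hker₂ : ι₂.range = π₂.ker)
    -- the sum extension `P₁₂ ⧸ D₁₂`
    [Group (FiberProd π₁ π₂)]
    (hmul₁₂ : ∀ p q : FiberProd π₁ π₂,
      (p * q).1 =
        (ι₁ (Circle.negOne ^ (δ₂ (π₁ p.1.1) * δ₁ (π₁ q.1.1)).val) * (p.1.1 * q.1.1),
         p.1.2 * q.1.2))
    (D₁₂ : Subgroup (FiberProd π₁ π₂))
    (hD₁₂ : ∀ p : FiberProd π₁ π₂, p ∈ D₁₂ ↔ ∃ μ : Circle, p.1 = (ι₁ μ, ι₂ μ⁻¹))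
    [D₁₂.Normal]
    -- the sum extension `P₂₁ ⧸ D₂₁`
    [Group (FiberProd π₂ π₁)]
    (hmul₂₁ : ∀ p q : FiberProd π₂ π₁,
      (p * q).1 =
        (ι₂ (Circle.negOne ^ (δ₁ (π₂ p.1.1) * δ₂ (π₂ q.1.1)).val) * (p.1.1 * q.1.1),
         p.1.2 * q.1.2))
    (D₂₁ : Subgroup (FiberProd π₂ π₁))
    (hD₂₁ : ∀ p : FiberProd π₂ π₁, p ∈ D₂₁ ↔ ∃ μ : Circle, p.1 = (ι₂ μ, ι₁ μ⁻¹))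
    [D₂₁.Normal] :
    ∃ ψ : (FiberProd π₁ π₂ ⧸ D₁₂) ≃* (FiberProd π₂ π₁ ⧸ D₂₁),
      -- `ψ [(x, y)] = [(ι₂((-1)^{δ₁(π₁ x)·δ₂(π₁ x)}) y, x)]`
      (∀ (p : FiberProd π₁ π₂) (p' : FiberProd π₂ π₁),
        p'.1 = (ι₂ (Circle.negOne ^ (δ₁ (π₁ p.1.1) * δ₂ (π₁ p.1.1)).val) * p.1.2, p.1.1) →
        ψ (QuotientGroup.mk p) = QuotientGroup.mk p') ∧
      -- `ψ` commutes with the projections to `G`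
      (∀ (p : FiberProd π₁ π₂) (p' : FiberProd π₂ π₁),
        ψ (QuotientGroup.mk p) = QuotientGroup.mk p' → π₂ p'.1.1 = π₁ p.1.1) ∧
      -- `ψ` commutes with the embeddings of `Circle`
      (∀ (l : Circle) (p : FiberProd π₁ π₂) (p' : FiberProd π₂ π₁),
        p.1 = (ι₁ l, 1) → p'.1 = (ι₂ l, 1) →
        ψ (QuotientGroup.mk p) = QuotientGroup.mk p') := by
  have hδ₁1 : δ₁ 1 = 0 := by simpa using hδ₁ 1 1
  have hδ₂1 : δ₂ 1 = 0 := by simpa using hδ₂ 1 1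
  have hπι₁ : ∀ μ, π₁ (ι₁ μ) = 1 := fun μ => by
    have : ι₁ μ ∈ π₁.ker := hker₁ ▸ ⟨μ, rfl⟩
    exact this
  have hπι₂ : ∀ μ, π₂ (ι₂ μ) = 1 := fun μ => by
    have : ι₂ μ ∈ π₂.ker := hker₂ ▸ ⟨μ, rfl⟩
    exact this
  have hc₂ : ∀ μ x, x * ι₂ μ = ι₂ μ * x := fun μ x =>
    Subgroup.mem_center_iff.1 (hcent₂ ⟨μ, rfl⟩) x
  have e₁₂ := sum_mk_eq_iff δ₁ δ₂ hδ₁ π₁ ι₁ hcent₁ hker₁ π₂ ι₂ hcent₂ hker₂ hmul₁₂ D₁₂ hD₁₂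
  have e₂₁ := sum_mk_eq_iff δ₂ δ₁ hδ₂ π₂ ι₂ hcent₂ hker₂ π₁ ι₁ hcent₁ hker₁ hmul₂₁ D₂₁ hD₂₁
  let s : G → Circle := fun g => Circle.negOne ^ (δ₁ g * δ₂ g).val
  have hss : ∀ g, s g * s g = 1 := fun g => negOne_pow_val_mul_self _
  let f : FiberProd π₁ π₂ → FiberProd π₂ π₁ := fun p =>
    ⟨(ι₂ (s (π₁ p.1.1)) * p.1.2, p.1.1), by simp only [map_mul, hπι₂, one_mul, p.2]⟩
  let F : FiberProd π₁ π₂ →* FiberProd π₂ π₁ ⧸ D₂₁ := MonoidHom.mk' (fun p => QuotientGroup.mk (f p)) (by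
    intro p q
    rw [← QuotientGroup.mk_mul, e₂₁, hmul₂₁, ]
    have hf : (f (p * q)).1 = (ι₂ (s (π₁ (p * q).1.1)) * (p * q).1.2, (p * q).1.1) := rfl
    have hp : π₂ p.1.2 = π₁ p.1.1 := p.2.symm
    have hq : π₂ q.1.2 = π₁ q.1.1 := q.2.symm
    rw [hf, hmul₁₂]
    simp only [f, map_mul, hπι₁, hπι₂, one_mul, hp, hq]
    generalize π₁ p.1.1 = g
    generalize π₁ q.1.1 = h
    have hsm : s (g * h) = s g * s h * Circle.negOne ^ (δ₁ g * δ₂ h).val *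
        Circle.negOne ^ (δ₂ g * δ₁ h).val := by
      simp only [s, ← negOne_pow_val_add, hδ₁, hδ₂]
      congr 2
      ring
    have ht := negOne_pow_val_mul_self (δ₂ g * δ₁ h)
    rw [hsm]
    generalize Circle.negOne ^ (δ₁ g * δ₂ h).val = u at *
    generalize Circle.negOne ^ (δ₂ g * δ₁ h).val = t at *
    refine ⟨t, ?_, ?_⟩
    · have h1 : ι₂ (s g) * p.1.2 * (ι₂ (s h) * q.1.2)
          = ι₂ (s g * s h) * (p.1.2 * q.1.2) := by
        rw [map_mul, mul_assoc, ← mul_assoc p.1.2, hc₂]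
        simp only [mul_assoc]
      rw [h1]
      simp only [← mul_assoc, ← map_mul]
      rw [mul_assoc (ι₂ _), mul_assoc (ι₂ _)]
      congr 2
      calc u * s g * s h = (t * t) * (u * s g * s h) := by rw [ht, one_mul]
        _ = _ := by ac_rfl
    · rw [← mul_assoc, ← map_mul, inv_mul_cancel, map_one, one_mul])
  have hF : ∀ p q, F p = F q ↔
      (QuotientGroup.mk p : FiberProd π₁ π₂ ⧸ D₁₂) = QuotientGroup.mk q := by
    intro p q
    change (QuotientGroup.mk (f p) : FiberProd π₂ π₁ ⧸ D₂₁) = QuotientGroup.mk (f q) ↔ _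
    rw [e₁₂, e₂₁]
    simp only [f]
    have aux : ∀ μ : Circle, q.1.1 = ι₁ μ * p.1.1 → π₁ q.1.1 = π₁ p.1.1 := by
      intro μ h
      rw [h, map_mul, hπι₁, one_mul]
    constructor
    · rintro ⟨μ, h1, h2⟩
      refine ⟨μ⁻¹, h2, ?_⟩
      rw [aux _ h2, ← mul_assoc, ← map_mul, mul_comm μ, map_mul, mul_assoc] at h1
      rw [inv_inv]
      exact mul_left_cancel h1
    · rintro ⟨μ, h1, h2⟩
      refine ⟨μ⁻¹, ?_, by rw [inv_inv]; exact h1⟩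
      rw [aux _ h1, h2, ← mul_assoc, ← map_mul, mul_comm, map_mul, mul_assoc]
  let L : FiberProd π₁ π₂ ⧸ D₁₂ →* FiberProd π₂ π₁ ⧸ D₂₁ := QuotientGroup.lift D₁₂ F (by
    intro p hp
    rw [MonoidHom.mem_ker, ← map_one F, hF]
    exact (QuotientGroup.eq_one_iff p).2 hp)
  have hL : ∀ p : FiberProd π₁ π₂, L (QuotientGroup.mk p) = QuotientGroup.mk (f p) :=
    fun p => rfl
  have hbij : Function.Bijective L := by
    constructor
    · intro a b
      induction a using QuotientGroup.induction_on
      induction b using QuotientGroup.induction_on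
      exact (hF _ _).1
    · intro b
      induction b using QuotientGroup.induction_on with
      | H z =>
        refine ⟨QuotientGroup.mk ⟨(z.1.2, ι₂ (s (π₁ z.1.2)) * z.1.1), ?_⟩, ?_⟩
        · simp only [map_mul, hπι₂, one_mul, z.2]
        · rw [hL]
          congr 1
          apply Subtype.ext
          simp only [f]
          rw [← mul_assoc, ← map_mul, hss, map_one, one_mul]
  refine ⟨MulEquiv.ofBijective L hbij, ?_, ?_, ?_⟩
  · intro p p' h
    change L (QuotientGroup.mk p) = _
    rw [hL]
    congr 1
    exact Subtype.ext h.symm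
  · intro p p' h
    change L (QuotientGroup.mk p) = _ at h
    rw [hL, e₂₁] at h
    obtain ⟨μ, h1, h2⟩ := h
    rw [p'.2, h2, map_mul, hπι₁, one_mul]
  · intro l p p' h h'
    change L (QuotientGroup.mk p) = _
    rw [hL, e₂₁]
    refine ⟨l, ?_, ?_⟩
    · simp [f, s, h, h', hπι₁, hδ₁1]
    · simp [f, h, h', ← map_mul]
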